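/- arXiv:2406.19907 — 2 statements merged into one kernel-verified Lean document; each statement's English description precedes it below -/
import Mathlib

section
/- There exists an absolute constant C > 0 such that for all t > 0 and all r ≥ 0, ∫_{ℝ²} min(|ξ|² r², 4) / (|ξ|² (1 + t|ξ|²)) dξ ≤ C ln(2 + r/√t). -/
open MeasureTheory Set

lemma radial_aux (t R : ℝ) (ht : 0 < t) (hR : 0 < R) (h : 16 * t ≤ R ^ 2) :
    IntegrableOn (fun s : ℝ => s * ((R^2 - 4*t) / ((4 + R^2*s^2) * (1 + t*s^2)))) (Ioi 0) ∧
    ∫ s in Ioi (0:ℝ), s * ((R^2 - 4*t) / ((4 + R^2*s^2) * (1 + t*s^2))) =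
      1/2 * Real.log (R^2/t) - 1/2 * Real.log 4 := by
  have hd : ∀ s ∈ Ici (0:ℝ), HasDerivAt
      (fun s : ℝ => 1/2 * (Real.log (4 + R^2*s^2) - Real.log (1 + t*s^2)))
      (s * ((R^2 - 4*t) / ((4 + R^2*s^2) * (1 + t*s^2)))) s := by
    intro s _
    have h1 : 0 < 4 + R^2*s^2 := by positivity
    have h2 : 0 < 1 + t*s^2 := by positivity
    have a1 : HasDerivAt (fun s : ℝ => 4 + R^2*s^2) (R^2*(2*s)) s := by
      simpa using ((hasDerivAt_pow 2 s).const_mul (R^2)).const_add 4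
    have a2 : HasDerivAt (fun s : ℝ => 1 + t*s^2) (t*(2*s)) s := by
      simpa using ((hasDerivAt_pow 2 s).const_mul t).const_add 1
    refine (((a1.log h1.ne').sub (a2.log h2.ne')).const_mul (1/2)).congr_deriv ?_
    field_simp
    ring
  have hn : ∀ s ∈ Ioi (0:ℝ), 0 ≤ s * ((R^2 - 4*t) / ((4 + R^2*s^2) * (1 + t*s^2))) := by
    intro s hs
    have : 0 < s := hs
    have : 0 ≤ R^2 - 4*t := by linarith
    positivity
  have hl : Filter.Tendsto
      (fun s : ℝ => 1/2 * (Real.log (4 + R^2*s^2) - Real.log (1 + t*s^2)))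
      Filter.atTop (nhds (1/2 * Real.log (R^2/t))) := by
    have e : (fun s : ℝ => 1/2 * (Real.log (4 + R^2*s^2) - Real.log (1 + t*s^2))) =
        fun s : ℝ => 1/2 * Real.log (R^2/t + (4 - R^2/t) * (1 + t*s^2)⁻¹) := by
      funext s
      have h1 : 0 < 4 + R^2*s^2 := by positivity
      have h2 : 0 < 1 + t*s^2 := by positivity
      rw [← Real.log_div h1.ne' h2.ne']
      congr 2
      field_simp
      ring
    rw [e]
    have b : Filter.Tendsto (fun s : ℝ => 1 + t*s^2) Filter.atTop Filter.atTop :=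
      Filter.tendsto_atTop_add_const_left _ _
        ((Filter.tendsto_pow_atTop (by norm_num)).const_mul_atTop ht)
    have c := ((b.inv_tendsto_atTop).const_mul (4 - R^2/t)).const_add (R^2/t)
    rw [mul_zero, add_zero] at c
    exact (c.log (by positivity)).const_mul _
  refine ⟨integrableOn_Ioi_deriv_of_nonneg' hd hn hl, ?_⟩
  rw [integral_Ioi_of_hasDerivAt_of_nonneg' hd hn hl]
  simp

/-- **Frequency-space logarithmic integral bound.**
There exists an absolute constant `C > 0` such that for all `t > 0` and all `r ≥ 0`,
`∫_{ℝ²} min(|ξ|² r², 4) / (|ξ|² (1 + t|ξ|²)) dξ ≤ C ln(2 + r/√t)`. -/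
theorem frequency_log_integral_bound :
    ∃ C : ℝ, 0 < C ∧ ∀ (t r : ℝ), 0 < t → 0 ≤ r →
      ∫⁻ ξ : EuclideanSpace ℝ (Fin 2),
          ENNReal.ofReal (min (‖ξ‖ ^ 2 * r ^ 2) 4 / (‖ξ‖ ^ 2 * (1 + t * ‖ξ‖ ^ 2))) ≤
        ENNReal.ofReal (C * Real.log (2 + r / Real.sqrt t)) := by
  set V : ℝ := (volume : Measure (EuclideanSpace ℝ (Fin 2))).real (Metric.ball 0 1) with hV
  have hV0 : 0 ≤ V := measureReal_nonneg
  refine ⟨32/3 * (2 * V) + 1, by positivity, fun t r ht hr => ?_⟩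
  have hq : 0 < Real.sqrt t := Real.sqrt_pos.2 ht
  have hqt : Real.sqrt t ^ 2 = t := Real.sq_sqrt ht.le
  set q := Real.sqrt t
  set R := r + 4 * q with hRdef
  have hR : 0 < R := by positivity
  have hrR : r ^ 2 ≤ R ^ 2 := by gcongr; linarith
  have h16 : 16 * t ≤ R ^ 2 := by rw [← hqt, hRdef]; nlinarith [mul_nonneg hr hq.le, sq_nonneg r]
  obtain ⟨hi, hv⟩ := radial_aux t R ht hR h16
  set f : ℝ → ℝ := fun s => (R^2 - 4*t) / ((4 + R^2*s^2) * (1 + t*s^2)) with hf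
  have hf0 : ∀ s, 0 ≤ f s := by
    intro s
    have : 0 ≤ R^2 - 4*t := by linarith
    simp only [hf]
    positivity
  have hint : Integrable (fun ξ : EuclideanSpace ℝ (Fin 2) => f ‖ξ‖) volume := by
    rw [integrable_fun_norm_addHaar volume (f := f)]
    simpa using hi
  have hval : ∫ ξ : EuclideanSpace ℝ (Fin 2), f ‖ξ‖ =
      2 * V * (1/2 * Real.log (R^2/t) - 1/2 * Real.log 4) := by
    rw [integral_fun_norm_addHaar volume f, ← hv]
    simp [hV]
    ring
  have hlog : 1/2 * Real.log (R^2/t) - 1/2 * Real.log 4 ≤ Real.log (2 + r / q) := by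
    have e : R^2/t = 4 * (2 + r / q / 2)^2 := by
      rw [← hqt, hRdef]; field_simp; ring
    have hx : 0 ≤ r / q := by positivity
    rw [e, Real.log_mul (by norm_num) (by positivity), Real.log_pow]
    have : Real.log (2 + r / q / 2) ≤ Real.log (2 + r / q) :=
      Real.log_le_log (by positivity) (by linarith)
    push_cast
    linarith
  have hlog0 : 0 ≤ Real.log (2 + r / q) :=
    Real.log_nonneg (by have : 0 ≤ r / q := by positivity
                        linarith)
  have hpt : ∀ s : ℝ, min (s^2 * r^2) 4 / (s^2 * (1 + t * s^2)) ≤ 32/3 * f s := by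
    intro s
    rcases eq_or_ne s 0 with rfl | hs
    · simpa using hf0 0
    have hs2 : 0 < s^2 := by positivity
    have h2 : 0 < 1 + t*s^2 := by positivity
    have h1 : 0 < 4 + R^2*s^2 := by positivity
    have m : min (s^2 * r^2) 4 * (4 + R^2*s^2) ≤ 8 * (R^2 * s^2) := by
      have m1 : min (s^2 * r^2) 4 ≤ s^2 * R^2 :=
        (min_le_left _ _).trans (by gcongr)
      have m2 : min (s^2 * r^2) 4 ≤ 4 := min_le_right _ _
      have := mul_le_mul_of_nonneg_right m2 (by positivity : 0 ≤ R^2*s^2)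
      nlinarith
    have m' : 8 * (R^2 * s^2) ≤ 32/3 * (R^2 - 4*t) * s^2 := by nlinarith
    simp only [hf]
    rw [← mul_div_assoc, div_le_div_iff₀ (by positivity) (by positivity)]
    nlinarith [mul_le_mul_of_nonneg_right (m.trans m') h2.le]
  calc _ ≤ ∫⁻ ξ : EuclideanSpace ℝ (Fin 2), ENNReal.ofReal (32/3 * f ‖ξ‖) :=
        lintegral_mono fun ξ => ENNReal.ofReal_le_ofReal (hpt _)
    _ = ENNReal.ofReal (∫ ξ : EuclideanSpace ℝ (Fin 2), 32/3 * f ‖ξ‖) :=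
        (ofReal_integral_eq_lintegral_ofReal (hint.const_mul _)
          (Filter.Eventually.of_forall fun ξ => mul_nonneg (by norm_num) (hf0 _))).symm
    _ ≤ _ := by
        apply ENNReal.ofReal_le_ofReal
        rw [integral_const_mul, hval]
        have := mul_le_mul_of_nonneg_left hlog (by positivity : 0 ≤ 32/3 * (2 * V))
        linarith
end

section
/- Let T > 0, A > 0, and let f : (0,T] → [0,∞] be a measurable function with f ∈ L⁴(0,T). Define F(t) := (1/t) ∫₀ᵗ f(s) e^{A |ln(t/s)|^{1/2}} ds for t ∈ (0,T]. Then F ∈ L⁴(0,T) and ‖F‖_{L⁴(0,T)} ≤ C_A ‖f‖_{L⁴(0,T)}, where C_A > 0 is a constant depending only on A. -/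
open MeasureTheory Set

lemma aux_kernel (A t s : ℝ) (hs : 0 < s) (hst : s ≤ t) :
    Real.exp (A * Real.sqrt |Real.log (t / s)|) ≤
      Real.exp (A^2) * t ^ (1/4 : ℝ) * (s ^ (1/4 : ℝ) * s ^ (-(1/2) : ℝ)) := by
  have ht : 0 < t := lt_of_lt_of_le hs hst
  have hL : 0 ≤ Real.log (t / s) := Real.log_nonneg (by rw [le_div_iff₀ hs]; linarith)
  rw [abs_of_nonneg hL]
  rw [← Real.rpow_add hs, Real.rpow_def_of_pos ht, Real.rpow_def_of_pos hs, ← Real.exp_add,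
    ← Real.exp_add]
  apply Real.exp_le_exp.2
  have h1 := Real.sq_sqrt hL
  have h2 := Real.log_div ht.ne' hs.ne'
  nlinarith [sq_nonneg (A - Real.sqrt (Real.log (t / s)) / 2)]

lemma aux_int1 (t : ℝ) (ht : 0 < t) :
    ∫⁻ s in Ioc (0 : ℝ) t, (ENNReal.ofReal (s ^ (-(1/2) : ℝ))) ^ (4/3 : ℝ) =
      ENNReal.ofReal (3 * t ^ (1/3 : ℝ)) := by
  have h0 : ∀ s ∈ Ioc (0:ℝ) t, (ENNReal.ofReal (s ^ (-(1/2) : ℝ))) ^ (4/3 : ℝ) =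
      ENNReal.ofReal (s ^ (-(2/3) : ℝ)) := by
    intro s hs
    rw [ENNReal.ofReal_rpow_of_nonneg (Real.rpow_nonneg hs.1.le _) (by norm_num),
      ← Real.rpow_mul hs.1.le]
    norm_num
  rw [setLIntegral_congr_fun measurableSet_Ioc h0]
  have hi : IntervalIntegrable (fun s : ℝ => s ^ (-(2/3) : ℝ)) volume 0 t :=
    intervalIntegral.intervalIntegrable_rpow' (by norm_num)
  rw [← ofReal_integral_eq_lintegral_ofReal
    ((intervalIntegrable_iff_integrableOn_Ioc_of_le ht.le).1 hi)]
  · rw [← intervalIntegral.integral_of_le ht.le, integral_rpow (Or.inl (by norm_num))]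
    congr 1
    norm_num
    ring
  · filter_upwards [ae_restrict_mem measurableSet_Ioc] with s hs
    exact Real.rpow_nonneg hs.1.le _

lemma aux_int2 (s : ℝ) (hs : 0 < s) :
    ∫⁻ t in Ioi s, ENNReal.ofReal (t ^ (-2 : ℝ)) = ENNReal.ofReal (s⁻¹) := by
  rw [← ofReal_integral_eq_lintegral_ofReal (integrableOn_Ioi_rpow_of_lt (by norm_num) hs)]
  · rw [integral_Ioi_rpow_of_lt (by norm_num) hs]
    congr 1
    norm_num [Real.rpow_neg_one]
  · filter_upwards [ae_restrict_mem measurableSet_Ioi] with t ht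
    exact Real.rpow_nonneg (hs.le.trans (le_of_lt ht)) _

lemma aux_point (A t : ℝ) (ht : 0 < t) (f : ℝ → ENNReal) (hf : Measurable f) :
    ((∫⁻ s in Ioc (0 : ℝ) t,
        f s * ENNReal.ofReal (Real.exp (A * Real.sqrt |Real.log (t / s)|))) /
            ENNReal.ofReal t) ^ 4 ≤
      ENNReal.ofReal (27 * Real.exp (A^2) ^ 4) * (ENNReal.ofReal (t ^ (-2 : ℝ)) *
        ∫⁻ s in Ioc (0 : ℝ) t, f s ^ 4 * ENNReal.ofReal s) := by
  set K := Real.exp (A^2) with hK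
  have hKp : 0 < K := Real.exp_pos _
  have h1 : (∫⁻ s in Ioc (0 : ℝ) t,
        f s * ENNReal.ofReal (Real.exp (A * Real.sqrt |Real.log (t / s)|))) ≤
      ENNReal.ofReal (K * t ^ (1/4 : ℝ)) * ∫⁻ s in Ioc (0 : ℝ) t,
        ((fun s => f s * ENNReal.ofReal (s ^ (1/4 : ℝ))) *
          (fun s => ENNReal.ofReal (s ^ (-(1/2) : ℝ)))) s := by
    rw [← lintegral_const_mul _ (by
      simp only [Pi.mul_def]; fun_prop)]
    apply setLIntegral_mono' measurableSet_Ioc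
    intro s hs
    have h := ENNReal.ofReal_le_ofReal (aux_kernel A t s hs.1 hs.2)
    rw [ENNReal.ofReal_mul (by positivity),
      ENNReal.ofReal_mul (Real.rpow_nonneg hs.1.le _)] at h
    calc _ ≤ f s * _ := mul_le_mul_right h _
      _ = _ := by simp only [Pi.mul_apply, ← hK]; ring
  have h2 := ENNReal.lintegral_mul_le_Lp_mul_Lq (volume.restrict (Ioc (0:ℝ) t))
    (p := 4) (q := 4/3) (by rw [Real.holderConjugate_iff]; norm_num)
    (f := fun s => f s * ENNReal.ofReal (s ^ (1/4 : ℝ)))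
    (g := fun s => ENNReal.ofReal (s ^ (-(1/2) : ℝ))) (by fun_prop) (by fun_prop)
  have h3 : ∫⁻ s in Ioc (0:ℝ) t, (f s * ENNReal.ofReal (s ^ (1/4 : ℝ))) ^ (4:ℝ) =
      ∫⁻ s in Ioc (0 : ℝ) t, f s ^ 4 * ENNReal.ofReal s := by
    apply setLIntegral_congr_fun measurableSet_Ioc
    intro s hs
    simp only
    rw [ENNReal.mul_rpow_of_nonneg _ _ (by norm_num),
      ENNReal.ofReal_rpow_of_nonneg (Real.rpow_nonneg hs.1.le _) (by norm_num),
      ← Real.rpow_mul hs.1.le]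
    norm_num
  rw [h3, aux_int1 t ht] at h2
  set G := ∫⁻ s in Ioc (0 : ℝ) t, f s ^ 4 * ENNReal.ofReal s
  have h4 : (G ^ (1/4 : ℝ)) ^ 4 = G := by
    rw [← ENNReal.rpow_natCast, ← ENNReal.rpow_mul]; norm_num
  have h5 : (ENNReal.ofReal (3 * t ^ (1/3 : ℝ)) ^ (1 / (4/3) : ℝ)) ^ 4 =
      ENNReal.ofReal (27 * t) := by
    rw [← ENNReal.rpow_natCast, ← ENNReal.rpow_mul,
      ENNReal.ofReal_rpow_of_nonneg (by positivity) (by norm_num)]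
    congr 1
    rw [show (1 / (4/3) * ((4:ℕ):ℝ) : ℝ) = ((3:ℕ):ℝ) by norm_num, Real.rpow_natCast, mul_pow,
      ← Real.rpow_natCast, ← Real.rpow_natCast, ← Real.rpow_mul ht.le]
    norm_num
  have h6 : ENNReal.ofReal (K * t ^ (1/4 : ℝ)) ^ 4 = ENNReal.ofReal (K^4 * t) := by
    rw [← ENNReal.ofReal_pow (by positivity), mul_pow, ← Real.rpow_natCast (t ^ (1/4:ℝ)),
      ← Real.rpow_mul ht.le]
    norm_num
  have h7 : (ENNReal.ofReal t)⁻¹ ^ 4 = ENNReal.ofReal (t⁻¹ ^ 4) := by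
    rw [← ENNReal.ofReal_inv_of_pos ht, ENNReal.ofReal_pow (by positivity)]
  have h8 := pow_le_pow_left' (h1.trans (mul_le_mul_right h2 _)) 4
  rw [mul_pow, mul_pow, h4, h5, h6] at h8
  rw [div_eq_mul_inv, mul_pow, h7]
  refine (mul_le_mul_left h8 _).trans (le_of_eq ?_)
  calc _ = (ENNReal.ofReal (K^4 * t) * ENNReal.ofReal (27 * t) * ENNReal.ofReal (t⁻¹ ^ 4)) * G := by
        ring
    _ = (ENNReal.ofReal (27 * K^4) * ENNReal.ofReal (t ^ (-2:ℝ))) * G := by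
        rw [← ENNReal.ofReal_mul (by positivity), ← ENNReal.ofReal_mul (by positivity),
          ← ENNReal.ofReal_mul (by positivity)]
        congr 2
        rw [Real.rpow_neg ht.le]
        norm_num
        field_simp
    _ = _ := by ring

lemma aux_tonelli (T : ℝ) (f : ℝ → ENNReal) (hf : Measurable f) :
    (∫⁻ t in Ioc (0:ℝ) T, ENNReal.ofReal (t ^ (-2 : ℝ)) *
        ∫⁻ s in Ioc (0 : ℝ) t, f s ^ 4 * ENNReal.ofReal s) ≤
      ∫⁻ s in Ioc (0 : ℝ) T, f s ^ 4 := by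
  let k : ℝ → ℝ → ENNReal := fun t s =>
    {p : ℝ × ℝ | p.2 < p.1}.indicator
      (fun p => ENNReal.ofReal (p.1 ^ (-2 : ℝ)) * (f p.2 ^ 4 * ENNReal.ofReal p.2)) (t, s)
  have hk : Measurable (Function.uncurry k) := by
    have : Function.uncurry k = {p : ℝ × ℝ | p.2 < p.1}.indicator
      (fun p => ENNReal.ofReal (p.1 ^ (-2 : ℝ)) * (f p.2 ^ 4 * ENNReal.ofReal p.2)) := rfl
    rw [this]
    exact Measurable.indicator (by fun_prop) (measurableSet_lt measurable_snd measurable_fst)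
  calc _ = ∫⁻ t in Ioc (0:ℝ) T, ∫⁻ s in Ioc (0:ℝ) T, k t s := by
        apply setLIntegral_congr_fun measurableSet_Ioc
        intro t ht
        simp only
        have : ∀ s, k t s = (Iio t).indicator
          (fun s => ENNReal.ofReal (t ^ (-2 : ℝ)) * (f s ^ 4 * ENNReal.ofReal s)) s := by
          intro s; simp [k, indicator_apply]
        simp_rw [this]
        rw [setLIntegral_indicator measurableSet_Iio, lintegral_const_mul _ (by fun_prop)]
        congr 1
        apply setLIntegral_congr
        have : Iio t ∩ Ioc 0 T = Ioo 0 t := by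
          ext s; simp only [mem_inter_iff, mem_Iio, mem_Ioc, mem_Ioo]
          constructor
          · rintro ⟨a, b, c⟩; exact ⟨b, a⟩
          · rintro ⟨a, b⟩; exact ⟨b, a, b.le.trans ht.2⟩
        rw [this]
        exact Ioo_ae_eq_Ioc.symm
    _ = ∫⁻ s in Ioc (0:ℝ) T, ∫⁻ t in Ioc (0:ℝ) T, k t s := lintegral_lintegral_swap hk.aemeasurable
    _ ≤ _ := by
        apply setLIntegral_mono' measurableSet_Ioc
        intro s hs
        have : ∀ t, k t s = (Ioi s).indicator
          (fun t => ENNReal.ofReal (t ^ (-2 : ℝ)) * (f s ^ 4 * ENNReal.ofReal s)) t := by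
          intro t; simp [k, indicator_apply]
        simp_rw [this]
        rw [setLIntegral_indicator measurableSet_Ioi, lintegral_mul_const _ (by fun_prop)]
        calc _ ≤ ENNReal.ofReal s⁻¹ * (f s ^ 4 * ENNReal.ofReal s) := by
              rw [← aux_int2 s hs.1]
              exact mul_le_mul_left (lintegral_mono_set inter_subset_left) _
          _ = (ENNReal.ofReal s⁻¹ * ENNReal.ofReal s) * f s ^ 4 := by ring
          _ = f s ^ 4 := by
              rw [← ENNReal.ofReal_mul (inv_nonneg.2 hs.1.le), inv_mul_cancel₀ hs.1.ne']
              simp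
          _ ≤ _ := le_rfl

/-- **Hardy-type inequality with logarithmic kernel.**
Let `T > 0`, `A > 0`, and let `f : (0,T] → [0,∞]` be measurable with `f ∈ L⁴(0,T)`.
Define `F(t) := (1/t) ∫₀ᵗ f(s) e^{A |ln(t/s)|^{1/2}} ds` for `t ∈ (0,T]`. Then
`F ∈ L⁴(0,T)` with `‖F‖_{L⁴(0,T)} ≤ C_A ‖f‖_{L⁴(0,T)}`, where `C_A` depends only on `A`. -/
theorem hardy_log_kernel_L4 (A : ℝ) (hA : 0 < A) :
    ∃ C : ℝ, 0 < C ∧ ∀ (T : ℝ) (f : ℝ → ENNReal), 0 < T → Measurable f →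
      (∫⁻ s in Ioc (0 : ℝ) T, f s ^ 4) < ⊤ →
      (∫⁻ t in Ioc (0 : ℝ) T,
          ((∫⁻ s in Ioc (0 : ℝ) t,
              f s * ENNReal.ofReal (Real.exp (A * Real.sqrt |Real.log (t / s)|))) /
            ENNReal.ofReal t) ^ 4) ≤
        ENNReal.ofReal (C ^ 4) * ∫⁻ s in Ioc (0 : ℝ) T, f s ^ 4 := by
  refine ⟨3 * Real.exp (A^2), by positivity, ?_⟩
  intro T f hT hf _
  calc _ ≤ ∫⁻ t in Ioc (0:ℝ) T, ENNReal.ofReal (27 * Real.exp (A^2) ^ 4) *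
        (ENNReal.ofReal (t ^ (-2 : ℝ)) * ∫⁻ s in Ioc (0 : ℝ) t, f s ^ 4 * ENNReal.ofReal s) :=
        setLIntegral_mono' measurableSet_Ioc (fun t ht => aux_point A t ht.1 f hf)
    _ = ENNReal.ofReal (27 * Real.exp (A^2) ^ 4) * ∫⁻ t in Ioc (0:ℝ) T,
        (ENNReal.ofReal (t ^ (-2 : ℝ)) * ∫⁻ s in Ioc (0 : ℝ) t, f s ^ 4 * ENNReal.ofReal s) :=
        lintegral_const_mul' _ _ ENNReal.ofReal_ne_top
    _ ≤ _ := by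
        refine mul_le_mul' (ENNReal.ofReal_le_ofReal ?_) (aux_tonelli T f hf)
        have : 0 < Real.exp (A^2) ^ 4 := by positivity
        rw [mul_pow]
        nlinarith
end
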